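/- arXiv:0902.0621 — 3 statements merged into one kernel-verified Lean document; each statement's English description precedes it below -/
import Mathlib

section
/- The set {μ ∈ Λ(E8) : μ·ρ = 1 and μ·μ = 4} consists exactly of the vectors 2e_i (0 ≤ i ≤ 7), the vectors e_i + e_j + e_k − e_l with i, j, k, l pairwise distinct indices in {0,…,7} and i < j < k, the vectors ρ − 2e_i (0 ≤ i ≤ 7), and the vectors ρ + e_i − e_j − e_k − e_l with i, j, k, l pairwise distinct and j < k < l. -/
noncomputable section

/-- Standard basis vector `e i` of `ℝ^8`. -/
def e (i : Fin 8) : Fin 8 → ℝ := fun k => if k = i then 1 else 0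

/-- The vector `ρ = (1/2, …, 1/2)`. -/
def ρ : Fin 8 → ℝ := fun _ => 1 / 2

/-- Standard inner product on `ℝ^8`. -/
def dot (x y : Fin 8 → ℝ) : ℝ := ∑ i, x i * y i

/-- The `E8` root lattice `Λ(E8) = ℤ^8 ∪ (ℤ^8 + ρ)`. -/
def LatticeE8 : Set (Fin 8 → ℝ) :=
  {v | (∀ i, ∃ n : ℤ, v i = n) ∨ (∀ i, ∃ n : ℤ, v i = n + 1 / 2)}

/-- The `E8` root system `R(E8) = {v ∈ Λ(E8) : v·v = 2}`. -/
def RE8 : Set (Fin 8 → ℝ) := {v ∈ LatticeE8 | dot v v = 2}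

/-- The `E7` root system `R(E7) = {v ∈ R(E8) : v·ρ = 0}`. -/
def RE7 : Set (Fin 8 → ℝ) := {v ∈ RE8 | dot v ρ = 0}
/-- The integer vectors in `ℤ^8` with coordinate sum `2` and squared length `4`. -/
lemma int_sum_eq_two_and_sum_sq_eq_four_iff (m : Fin 8 → ℤ) :
    (∑ t, m t = 2 ∧ ∑ t, m t ^ 2 = 4) ↔
      (∃ i, m = Pi.single i 2) ∨
        ∃ i j k l : Fin 8, i < j ∧ j < k ∧ l ≠ i ∧ l ≠ j ∧ l ≠ k ∧
          m = Pi.single i 1 + Pi.single j 1 + Pi.single k 1 - Pi.single l 1 := by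
  constructor
  · rintro ⟨hsum, hsq⟩
    by_cases hbig : ∃ i, 2 ≤ |m i|
    · obtain ⟨i, hi⟩ := hbig
      left
      have hmi : 4 ≤ m i ^ 2 := by nlinarith [sq_abs (m i)]
      rw [← Finset.add_sum_erase _ _ (Finset.mem_univ i)] at hsum hsq
      have hnonneg : ∀ t ∈ Finset.univ.erase i, 0 ≤ m t ^ 2 := fun t _ => sq_nonneg _
      have hrest : ∑ t ∈ Finset.univ.erase i, m t ^ 2 = 0 :=
        le_antisymm (by linarith) (Finset.sum_nonneg hnonneg)
      have hzero : ∀ t, t ≠ i → m t = 0 := fun t ht =>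
        pow_eq_zero_iff two_ne_zero |>.1 <|
          (Finset.sum_eq_zero_iff_of_nonneg hnonneg).1 hrest t (by simp [ht])
      rw [Finset.sum_eq_zero (fun t ht => hzero t (Finset.ne_of_mem_erase ht))] at hsum
      refine ⟨i, funext fun t => ?_⟩
      by_cases ht : t = i
      · subst ht; simpa using hsum
      · simp [ht, hzero t ht]
    · push Not at hbig
      right
      have hcases : ∀ t, m t = -1 ∨ m t = 0 ∨ m t = 1 := fun t => by
        have := abs_lt.1 (hbig t)
        omega
      set P := Finset.univ.filter fun t => m t = 1 with hP
      set N := Finset.univ.filter fun t => m t = -1 with hN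
      have hdiff : ∑ t, m t = P.card - N.card := by
        rw [hP, hN, Finset.natCast_card_filter, Finset.natCast_card_filter,
          ← Finset.sum_sub_distrib]
        refine Finset.sum_congr rfl fun t _ => ?_
        rcases hcases t with h | h | h <;> simp [h]
      have hadd : ∑ t, m t ^ 2 = P.card + N.card := by
        rw [hP, hN, Finset.natCast_card_filter, Finset.natCast_card_filter,
          ← Finset.sum_add_distrib]
        refine Finset.sum_congr rfl fun t _ => ?_
        rcases hcases t with h | h | h <;> simp [h]
      have hPcard : P.card = 3 := by omega
      have hNcard : N.card = 1 := by omega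
      obtain ⟨l, hl⟩ := Finset.card_eq_one.1 hNcard
      set f := P.orderEmbOfFin hPcard with hf
      have hmemP : ∀ t, m t = 1 ↔ t = f 0 ∨ t = f 1 ∨ t = f 2 := fun t => by
        have h := congrArg (t ∈ ·) (P.range_orderEmbOfFin hPcard)
        simp only [Set.mem_range, Fin.exists_fin_succ, hP] at h
        simpa [hf, eq_comm] using h.symm
      have hmemN : ∀ t, m t = -1 ↔ t = l := fun t => by
        have h := congrArg (t ∈ ·) hl
        simpa [hN] using h
      have h01 : f 0 < f 1 := f.strictMono (by decide)
      have h12 : f 1 < f 2 := f.strictMono (by decide)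
      have hml := (hmemN l).2 rfl
      have hl' : ¬(l = f 0 ∨ l = f 1 ∨ l = f 2) := fun h => by
        have := (hmemP l).2 h
        omega
      push Not at hl'
      refine ⟨f 0, f 1, f 2, l, h01, h12, hl'.1, hl'.2.1, hl'.2.2, funext fun t => ?_⟩
      have hPt := hmemP t
      have hNt := hmemN t
      have hct := hcases t
      simp only [Pi.add_apply, Pi.sub_apply, Pi.single_apply]
      grind
  · rintro (⟨i, rfl⟩ | ⟨i, j, k, l, hij, hjk, hli, hlj, hlk, rfl⟩)
    · simp [Pi.single_apply, ite_pow]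
    · have hik := hij.trans hjk
      constructor
      · simp [Finset.sum_add_distrib]
      · simp [sq, mul_add, mul_sub, Finset.sum_add_distrib, Finset.sum_sub_distrib,
          Pi.single_apply, hij.ne, hij.ne', hjk.ne, hjk.ne', hik.ne, hik.ne', hli, hlj, hlk,
          hli.symm, hlj.symm, hlk.symm]

/-- Membership in the weight set, in terms of integer vectors. -/
lemma mem_latticeE8_and_dot_iff (μ : Fin 8 → ℝ) :
    (μ ∈ LatticeE8 ∧ dot μ ρ = 1 ∧ dot μ μ = 4) ↔
      ∃ m : Fin 8 → ℤ, (∑ t, m t = 2 ∧ ∑ t, m t ^ 2 = 4) ∧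
        (μ = (fun t => (m t : ℝ)) ∨ μ = ρ - fun t => (m t : ℝ)) := by
  have key (m : Fin 8 → ℤ) : (∑ t, m t = 2 ∧ ∑ t, m t ^ 2 = 4) ↔
      (∑ t, (m t : ℝ) = 2 ∧ ∑ t, (m t : ℝ) ^ 2 = 4) := by
    norm_cast
  have hint (m : Fin 8 → ℤ) : (dot (fun t => (m t : ℝ)) ρ = 1 ∧
      dot (fun t => (m t : ℝ)) (fun t => (m t : ℝ)) = 4) ↔
      (∑ t, m t = 2 ∧ ∑ t, m t ^ 2 = 4) := by
    rw [key]
    simp only [dot, ρ, ← Finset.sum_mul, ← sq]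
    constructor <;> rintro ⟨h1, h2⟩ <;> constructor <;> linarith
  have hhalf (m : Fin 8 → ℤ) : (dot (ρ - fun t => (m t : ℝ)) ρ = 1 ∧
      dot (ρ - fun t => (m t : ℝ)) (ρ - fun t => (m t : ℝ)) = 4) ↔
      (∑ t, m t = 2 ∧ ∑ t, m t ^ 2 = 4) := by
    rw [key]
    simp only [dot, ρ, Pi.sub_apply, Fin.sum_univ_eight]
    constructor <;> rintro ⟨h1, h2⟩ <;> constructor <;> linarith
  constructor
  · rintro ⟨h | h, hdot⟩
    · choose m hm using h
      obtain rfl : μ = fun t => (m t : ℝ) := funext hm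
      exact ⟨m, (hint m).1 hdot, .inl rfl⟩
    · choose n hn using h
      have hμ : μ = ρ - fun t => ((-n t : ℤ) : ℝ) := by
        ext t
        simp [hn, ρ, add_comm]
      rw [hμ] at hdot
      exact ⟨fun t => -n t, (hhalf _).1 hdot, .inr hμ⟩
  · rintro ⟨m, hm, rfl | rfl⟩
    · exact ⟨.inl fun t => ⟨m t, rfl⟩, (hint m).2 hm⟩
    · exact ⟨.inr fun t => ⟨-m t, by simp [ρ]; ring⟩, (hhalf m).2 hm⟩

theorem statement2 :
    {μ ∈ LatticeE8 | dot μ ρ = 1 ∧ dot μ μ = 4} =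
      {μ | ∃ i : Fin 8, μ = (2 : ℝ) • e i} ∪
        {μ | ∃ i j k l : Fin 8, i < j ∧ j < k ∧ l ≠ i ∧ l ≠ j ∧ l ≠ k ∧
          μ = e i + e j + e k - e l} ∪
        {μ | ∃ i : Fin 8, μ = ρ - (2 : ℝ) • e i} ∪
        {μ | ∃ i j k l : Fin 8, j < k ∧ k < l ∧ i ≠ j ∧ i ≠ k ∧ i ≠ l ∧
          μ = ρ + e i - e j - e k - e l} := by
  have hsingle (i : Fin 8) : (fun t => ((Pi.single i 2 : Fin 8 → ℤ) t : ℝ)) = (2 : ℝ) • e i := by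
    ext t
    simp [e, Pi.single_apply]
  have hquad (i j k l : Fin 8) : (fun t => ((Pi.single i 1 + Pi.single j 1 + Pi.single k 1 -
      Pi.single l 1 : Fin 8 → ℤ) t : ℝ)) = e i + e j + e k - e l := by
    ext t
    simp [e, Pi.single_apply]
  have hneg (i j k l : Fin 8) : ρ - (e j + e k + e l - e i) = ρ + e i - e j - e k - e l := by
    abel
  ext μ
  simp only [Set.mem_ofPred_eq, Set.mem_union, mem_latticeE8_and_dot_iff,
    int_sum_eq_two_and_sum_sq_eq_four_iff]
  constructor
  · rintro ⟨m, ⟨i, rfl⟩ | ⟨i, j, k, l, hij, hjk, hli, hlj, hlk, rfl⟩, rfl | rfl⟩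
    · exact .inl (.inl (.inl ⟨i, hsingle i⟩))
    · exact .inl (.inr ⟨i, by rw [hsingle]⟩)
    · exact .inl (.inl (.inr ⟨i, j, k, l, hij, hjk, hli, hlj, hlk, hquad i j k l⟩))
    · exact .inr ⟨l, i, j, k, hij, hjk, hli, hlj, hlk, by rw [hquad, hneg]⟩
  · rintro (((⟨i, rfl⟩ | ⟨i, j, k, l, hij, hjk, hli, hlj, hlk, rfl⟩) | ⟨i, rfl⟩) |
      ⟨i, j, k, l, hjk, hkl, hij, hik, hil, rfl⟩)
    · exact ⟨_, .inl ⟨i, rfl⟩, .inl (hsingle i).symm⟩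
    · exact ⟨_, .inr ⟨i, j, k, l, hij, hjk, hli, hlj, hlk, rfl⟩, .inl (hquad i j k l).symm⟩
    · exact ⟨_, .inl ⟨i, rfl⟩, .inr (by rw [hsingle])⟩
    · exact ⟨_, .inr ⟨j, k, l, i, hjk, hkl, hij, hik, hil, rfl⟩, .inr (by rw [hquad, hneg])⟩
end
end

section
/- The Hesse polytope P^(1) equals the set of α ∈ ℝ^8 satisfying α·ρ = 1 together with: (i) α·δ ≤ 1 for every δ ∈ R(E7); (ii) α·μ ≤ 2 for every μ ∈ Λ(E8) with μ·ρ = 1 and μ·μ = 4. -/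
noncomputable section

/-- The Hesse polytope `P^(1)`: the convex hull of the vectors `e_i + e_j` and `ρ - e_i - e_j`
for `0 ≤ i < j ≤ 7`. -/
def Hesse : Set (Fin 8 → ℝ) :=
  convexHull ℝ
    ({v | ∃ i j : Fin 8, i < j ∧ v = e i + e j} ∪
      {v | ∃ i j : Fin 8, i < j ∧ v = ρ - e i - e j})

/-- The polytope cut out by the inequalities coming from `R(E7)` and from the vectors of norm `4`
in the affine lattice `{μ ∈ Λ(E8) | μ·ρ = 1}`. -/
def facetPolytope : Set (Fin 8 → ℝ) :=
  {α | dot α ρ = 1 ∧ (∀ δ ∈ RE7, dot α δ ≤ 1) ∧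
    (∀ μ ∈ LatticeE8, dot μ ρ = 1 → dot μ μ = 4 → dot α μ ≤ 2)}

lemma dot_comm (x y : Fin 8 → ℝ) : dot x y = dot y x := by
  simp only [dot, mul_comm]

lemma dot_add_left (x y z : Fin 8 → ℝ) : dot (x + y) z = dot x z + dot y z := by
  simp [dot, add_mul, Finset.sum_add_distrib]

lemma dot_sub_left (x y z : Fin 8 → ℝ) : dot (x - y) z = dot x z - dot y z := by
  simp [dot, sub_mul, Finset.sum_sub_distrib]

lemma dot_smul_left (c : ℝ) (x z : Fin 8 → ℝ) : dot (c • x) z = c * dot x z := by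
  simp [dot, Finset.mul_sum, mul_assoc]

lemma dot_neg_left (x z : Fin 8 → ℝ) : dot (-x) z = -dot x z := by
  simp [dot]

lemma dot_add_right (x y z : Fin 8 → ℝ) : dot x (y + z) = dot x y + dot x z := by
  simp only [dot_comm x, dot_add_left]

lemma dot_sub_right (x y z : Fin 8 → ℝ) : dot x (y - z) = dot x y - dot x z := by
  simp only [dot_comm x, dot_sub_left]

lemma dot_smul_right (c : ℝ) (x z : Fin 8 → ℝ) : dot x (c • z) = c * dot x z := by
  simp only [dot_comm x, dot_smul_left]

lemma dot_neg_right (x z : Fin 8 → ℝ) : dot x (-z) = -dot x z := by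
  simp [dot]

lemma dot_e (x : Fin 8 → ℝ) (i : Fin 8) : dot x (e i) = x i := by
  simp [dot, e]

lemma dot_rho_rho : dot ρ ρ = 2 := by
  simp only [dot, ρ, Finset.sum_const, Finset.card_univ, Fintype.card_fin]
  norm_num

lemma dot_self_nonneg (x : Fin 8 → ℝ) : 0 ≤ dot x x :=
  Finset.sum_nonneg fun i _ => mul_self_nonneg (x i)

lemma dot_comp_perm (σ : Equiv.Perm (Fin 8)) (x y : Fin 8 → ℝ) :
    dot (x ∘ σ) y = dot x (y ∘ σ.symm) := by
  simp only [dot, Function.comp_apply]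
  exact Fintype.sum_equiv σ _ _ fun i => by simp

lemma comp_perm_mem_latticeE8 (σ : Equiv.Perm (Fin 8)) {v : Fin 8 → ℝ} (hv : v ∈ LatticeE8) :
    v ∘ σ ∈ LatticeE8 :=
  hv.imp (fun h i => h (σ i)) (fun h i => h (σ i))

lemma neg_mem_latticeE8 {v : Fin 8 → ℝ} (hv : v ∈ LatticeE8) : -v ∈ LatticeE8 := by
  refine hv.imp (fun h i => ?_) (fun h i => ?_)
  · obtain ⟨n, hn⟩ := h i
    exact ⟨-n, by simp [hn]⟩
  · obtain ⟨n, hn⟩ := h i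
    exact ⟨-n - 1, by simp only [Pi.neg_apply, hn]; push_cast; ring⟩

lemma rho_sub_mem_latticeE8 {v : Fin 8 → ℝ} (hv : v ∈ LatticeE8) : ρ - v ∈ LatticeE8 := by
  refine hv.symm.imp (fun h i => ?_) (fun h i => ?_)
  · obtain ⟨n, hn⟩ := h i
    exact ⟨-n, by simp only [Pi.sub_apply, ρ, hn]; push_cast; ring⟩
  · obtain ⟨n, hn⟩ := h i
    exact ⟨-n, by simp only [Pi.sub_apply, ρ, hn]; push_cast; ring⟩

lemma comp_perm_mem_facetPolytope (σ : Equiv.Perm (Fin 8)) {α : Fin 8 → ℝ}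
    (hα : α ∈ facetPolytope) : α ∘ σ ∈ facetPolytope := by
  obtain ⟨h1, h2, h3⟩ := hα
  have hρ : ∀ τ : Equiv.Perm (Fin 8), ρ ∘ τ = ρ := fun _ => rfl
  have hρd : ∀ v, dot (v ∘ σ.symm) ρ = dot v ρ := fun v => by rw [dot_comp_perm, hρ]
  have hself : ∀ v, dot (v ∘ σ.symm) (v ∘ σ.symm) = dot v v := fun v => by
    rw [dot_comp_perm]
    congr 1
    ext i
    simp
  refine ⟨by rw [dot_comp_perm, hρ, h1], fun δ hδ => ?_, fun μ hμ hμρ hμμ => ?_⟩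
  · rw [dot_comp_perm]
    exact h2 _ ⟨⟨comp_perm_mem_latticeE8 _ hδ.1.1, (hself δ).trans hδ.1.2⟩, (hρd δ).trans hδ.2⟩
  · rw [dot_comp_perm]
    exact h3 _ (comp_perm_mem_latticeE8 _ hμ) ((hρd μ).trans hμρ) ((hself μ).trans hμμ)

lemma rho_sub_mem_facetPolytope {α : Fin 8 → ℝ} (hα : α ∈ facetPolytope) :
    ρ - α ∈ facetPolytope := by
  obtain ⟨h1, h2, h3⟩ := hα
  refine ⟨by rw [dot_sub_left, dot_rho_rho, h1]; norm_num, fun δ hδ => ?_,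
    fun μ hμ hμρ hμμ => ?_⟩
  · have h := h2 (-δ) ⟨⟨neg_mem_latticeE8 hδ.1.1, by
      rw [dot_neg_left, dot_neg_right, neg_neg, hδ.1.2]⟩, by rw [dot_neg_left, hδ.2, neg_zero]⟩
    rw [dot_neg_right] at h
    rw [dot_sub_left, dot_comm, hδ.2]
    linarith
  · have h := h3 (ρ - μ) (rho_sub_mem_latticeE8 hμ)
      (by rw [dot_sub_left, dot_rho_rho, hμρ]; norm_num)
      (by rw [dot_sub_left, dot_sub_right, dot_sub_right, dot_comm ρ μ, dot_rho_rho, hμρ, hμμ]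
          norm_num)
    rw [dot_sub_right, h1] at h
    rw [dot_sub_left, dot_comm, hμρ]
    linarith

lemma convex_facetPolytope : Convex ℝ facetPolytope := by
  rintro x ⟨hx1, hx2, hx3⟩ y ⟨hy1, hy2, hy3⟩ a b ha hb hab
  refine ⟨?_, fun δ hδ => ?_, fun μ hμ hμρ hμμ => ?_⟩ <;>
    simp only [dot_add_left, dot_smul_left]
  · rw [hx1, hy1]
    linarith
  · nlinarith [hx2 δ hδ, hy2 δ hδ]
  · nlinarith [hx3 μ hμ hμρ hμμ, hy3 μ hμ hμρ hμμ]

lemma exists_int_eq_add_of_mem_latticeE8 {v : Fin 8 → ℝ} (hv : v ∈ LatticeE8) (i j : Fin 8) :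
    ∃ n : ℤ, v i + v j = n := by
  rcases hv with h | h <;> obtain ⟨m, hm⟩ := h i <;> obtain ⟨n, hn⟩ := h j
  · exact ⟨m + n, by rw [hm, hn]; push_cast; ring⟩
  · exact ⟨m + n + 1, by rw [hm, hn]; push_cast; ring⟩

lemma e_add_e_mem_facetPolytope {i j : Fin 8} (hij : i ≠ j) : e i + e j ∈ facetPolytope := by
  have hdot : ∀ v, dot v (e i + e j) = v i + v j := fun v => by rw [dot_add_right, dot_e, dot_e]
  have hρ : dot ρ (e i + e j) = 1 := by rw [hdot]; norm_num [ρ]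
  have hself : dot (e i + e j) (e i + e j) = 2 := by
    rw [hdot]
    simp [e, hij, hij.symm]
    norm_num
  generalize e i + e j = v at hdot hρ hself ⊢
  refine ⟨by rw [dot_comm, hρ], fun δ hδ => ?_, fun μ hμ hμρ hμμ => ?_⟩
  · obtain ⟨n, hn⟩ := exists_int_eq_add_of_mem_latticeE8 hδ.1.1 i j
    have h := dot_self_nonneg (δ - v + (1 / 2 : ℝ) • ρ)
    rw [dot_comm, hdot, hn]
    simp only [dot_add_left, dot_add_right, dot_sub_left, dot_sub_right,
      dot_smul_left, dot_smul_right, dot_comm ρ δ, dot_comm v δ, dot_comm v ρ,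
      hρ, hself, hδ.1.2, hδ.2, dot_rho_rho] at h
    rw [hdot, hn] at h
    have : (n : ℝ) < 2 := by linarith
    have : n < 2 := by exact_mod_cast this
    exact_mod_cast (by omega : n ≤ 1)
  · obtain ⟨n, hn⟩ := exists_int_eq_add_of_mem_latticeE8 hμ i j
    have h := dot_self_nonneg (μ - (3 / 2 : ℝ) • v)
    rw [dot_comm, hdot, hn]
    simp only [dot_sub_left, dot_sub_right, dot_smul_left, dot_smul_right,
      dot_comm v μ, hself, hμμ] at h
    rw [hdot, hn] at h
    have : (n : ℝ) < 3 := by linarith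
    have : n < 3 := by exact_mod_cast this
    exact_mod_cast (by omega : n ≤ 2)

lemma hesse_subset_facetPolytope : Hesse ⊆ facetPolytope := by
  refine convexHull_min ?_ convex_facetPolytope
  rintro v (⟨i, j, hij, rfl⟩ | ⟨i, j, hij, rfl⟩)
  · exact e_add_e_mem_facetPolytope hij.ne
  · rw [sub_sub]
    exact rho_sub_mem_facetPolytope (e_add_e_mem_facetPolytope hij.ne)

lemma half_mem_latticeE8 {w : Fin 8 → ℤ} (hpar : (∀ i, w i % 2 = 0) ∨ ∀ i, w i % 2 = 1) :
    (fun i => (w i : ℝ) / 2) ∈ LatticeE8 := by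
  refine hpar.imp (fun h i => ⟨w i / 2, ?_⟩) (fun h i => ⟨w i / 2, ?_⟩)
  · have : (w i : ℝ) = ((2 * (w i / 2) : ℤ) : ℝ) := by rw [Int.cast_inj]; have := h i; omega
    push_cast at this
    linarith
  · have : (w i : ℝ) = ((2 * (w i / 2) + 1 : ℤ) : ℝ) := by rw [Int.cast_inj]; have := h i; omega
    push_cast at this
    linarith

/-- The points of the facet polytope satisfy the inequalities given by integer vectors `w` with
`w/2 ∈ R(E7)`. -/
lemma dot_le_of_half_mem_RE7 {x : Fin 8 → ℝ} (hx : x ∈ facetPolytope) (w : Fin 8 → ℤ)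
    (hpar : (∀ i, w i % 2 = 0) ∨ ∀ i, w i % 2 = 1) (hsum : ∑ i, w i = 0)
    (hsq : ∑ i, w i * w i = 8) : ∑ i, x i * w i ≤ 2 := by
  have hsum' : (∑ i, (w i : ℝ)) = 0 := by exact_mod_cast hsum
  have hsq' : (∑ i, (w i : ℝ) * w i) = 8 := by exact_mod_cast hsq
  have h := hx.2.1 (fun i => (w i : ℝ) / 2) ⟨⟨half_mem_latticeE8 hpar, ?_⟩, ?_⟩
  · simp only [dot, ← mul_div_assoc, ← Finset.sum_div] at h
    linarith
  · simp only [dot, div_mul_div_comm, ← Finset.sum_div, hsq']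
    norm_num
  · simp only [dot, ρ, ← Finset.sum_mul, ← Finset.sum_div, hsum']
    norm_num

/-- The points of the facet polytope satisfy the inequalities given by integer vectors `w` such
that `w/2` is a lattice vector of norm `4` whose product with `ρ` is `1`. -/
lemma dot_le_of_half_norm_four {x : Fin 8 → ℝ} (hx : x ∈ facetPolytope) (w : Fin 8 → ℤ)
    (hpar : (∀ i, w i % 2 = 0) ∨ ∀ i, w i % 2 = 1) (hsum : ∑ i, w i = 4)
    (hsq : ∑ i, w i * w i = 16) : ∑ i, x i * w i ≤ 4 := by
  have hsum' : (∑ i, (w i : ℝ)) = 4 := by exact_mod_cast hsum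
  have hsq' : (∑ i, (w i : ℝ) * w i) = 16 := by exact_mod_cast hsq
  have h := hx.2.2 (fun i => (w i : ℝ) / 2) (half_mem_latticeE8 hpar) ?_ ?_
  · simp only [dot, ← mul_div_assoc, ← Finset.sum_div] at h
    linarith
  · simp only [dot, ρ, ← Finset.sum_mul, ← Finset.sum_div, hsum']
    norm_num
  · simp only [dot, div_mul_div_comm, ← Finset.sum_div, hsq']
    norm_num

/-- A functional with decreasing coefficients which is larger at `e 0 + e 1` than at
`ρ - e 6 - e 7` attains its maximum over the facet polytope at `e 0 + e 1`. -/
lemma dot_le_of_antitone {x f : Fin 8 → ℝ} (hx : x ∈ facetPolytope) (hf : Antitone f)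
    (hmax : f 2 + f 3 + f 4 + f 5 ≤ f 0 + f 1 + f 6 + f 7) : dot x f ≤ f 0 + f 1 := by
  have hsum : x 0 + x 1 + x 2 + x 3 + x 4 + x 5 + x 6 + x 7 = 2 := by
    have h := hx.1
    simp only [dot, ρ, Fin.sum_univ_eight] at h
    linarith
  have r1 := dot_le_of_half_mem_RE7 hx ![2, 0, 0, 0, 0, 0, 0, -2] (by decide) (by decide) (by decide)
  have r2 := dot_le_of_half_mem_RE7 hx ![0, 2, 0, 0, 0, 0, 0, -2] (by decide) (by decide) (by decide)
  have r3 := dot_le_of_half_mem_RE7 hx ![2, 0, 0, 0, 0, 0, -2, 0] (by decide) (by decide) (by decide)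
  have r4 := dot_le_of_half_mem_RE7 hx ![0, 2, 0, 0, 0, 0, -2, 0] (by decide) (by decide) (by decide)
  have r5 := dot_le_of_half_mem_RE7 hx ![1, 1, 1, 1, -1, -1, -1, -1] (by decide) (by decide) (by decide)
  have r6 := dot_le_of_half_mem_RE7 hx ![1, 1, 1, -1, 1, -1, -1, -1] (by decide) (by decide) (by decide)
  have s1 := dot_le_of_half_norm_four hx ![4, 0, 0, 0, 0, 0, 0, 0] (by decide) (by decide) (by decide)
  have s2 := dot_le_of_half_norm_four hx ![0, 4, 0, 0, 0, 0, 0, 0] (by decide) (by decide) (by decide)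
  have s3 := dot_le_of_half_norm_four hx ![2, 2, 2, -2, 0, 0, 0, 0] (by decide) (by decide) (by decide)
  have s4 := dot_le_of_half_norm_four hx ![2, 2, 2, 0, -2, 0, 0, 0] (by decide) (by decide) (by decide)
  have s5 := dot_le_of_half_norm_four hx ![2, 2, 2, 0, 0, -2, 0, 0] (by decide) (by decide) (by decide)
  have s6 := dot_le_of_half_norm_four hx ![2, 2, 2, 0, 0, 0, -2, 0] (by decide) (by decide) (by decide)
  have s7 := dot_le_of_half_norm_four hx ![2, 2, 2, 0, 0, 0, 0, -2] (by decide) (by decide) (by decide)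
  have s8 := dot_le_of_half_norm_four hx ![3, 1, 1, 1, 1, -1, -1, -1] (by decide) (by decide) (by decide)
  have s9 := dot_le_of_half_norm_four hx ![1, 3, 1, 1, 1, -1, -1, -1] (by decide) (by decide) (by decide)
  simp [Fin.sum_univ_eight] at r1 r2 r3 r4 r5 r6 s1 s2 s3 s4 s5 s6 s7 s8 s9
  have hd : ∀ i j : Fin 8, i ≤ j → 0 ≤ f i - f j := fun i j hij => sub_nonneg.2 (hf hij)
  have d1 := hd 0 1 (by decide)
  have d2 := hd 1 2 (by decide)
  have d3 := hd 2 3 (by decide)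
  have d4 := hd 3 4 (by decide)
  have d5 := hd 4 5 (by decide)
  have d6 := hd 5 6 (by decide)
  have d7 := hd 6 7 (by decide)
  simp only [dot, Fin.sum_univ_eight]
  -- After summation by parts, the claim reads `∑ (f (i-1) - f i) * B i ≤ 0`.
  set B1 := x 0 - 1 with hB1
  set B2 := x 0 + x 1 - 2 with hB2
  set B3 := x 0 + x 1 + x 2 - 2 with hB3
  set B4 := x 0 + x 1 + x 2 + x 3 - 2 with hB4
  set B5 := -x 5 - x 6 - x 7 with hB5
  set B6 := -x 6 - x 7 with hB6
  set B7 := -x 7 with hB7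
  obtain ⟨t, ht0, h1, h2, h3, h5, h6, h7⟩ : ∃ t : ℝ, 0 ≤ t ∧ B1 ≤ -t ∧ B2 ≤ -(2 * t) ∧ B3 ≤ -t ∧
      B5 ≤ t ∧ B6 ≤ 2 * t ∧ B7 ≤ t := by
    refine ⟨max 0 (max B5 (max (B6 / 2) B7)), le_max_left _ _, ?_, ?_, ?_, ?_, ?_, ?_⟩
    · refine le_neg.2 (max_le ?_ (max_le ?_ (max_le ?_ ?_))) <;> linarith
    · refine le_neg.2 ((le_div_iff₀' two_pos).1 (max_le ?_ (max_le ?_ (max_le ?_ ?_)))) <;> linarith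
    · refine le_neg.2 (max_le ?_ (max_le ?_ (max_le ?_ ?_))) <;> linarith
    · simp
    · have : B6 / 2 ≤ max 0 (max B5 (max (B6 / 2) B7)) := by simp
      linarith
    · simp
  have h4 : B4 ≤ 0 := by linarith
  have key : (f 0 - f 1) * B1 + (f 1 - f 2) * B2 + (f 2 - f 3) * B3 + (f 3 - f 4) * B4 +
      (f 4 - f 5) * B5 + (f 5 - f 6) * B6 + (f 6 - f 7) * B7 ≤ 0 := by
    linarith [mul_le_mul_of_nonneg_left h1 d1, mul_le_mul_of_nonneg_left h2 d2,
      mul_le_mul_of_nonneg_left h3 d3, mul_le_mul_of_nonneg_left h4 d4,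
      mul_le_mul_of_nonneg_left h5 d5, mul_le_mul_of_nonneg_left h6 d6,
      mul_le_mul_of_nonneg_left h7 d7, mul_nonneg ht0 (sub_nonneg.2 hmax)]
  have hx4 : x 4 = 2 - (x 0 + x 1 + x 2 + x 3 + x 5 + x 6 + x 7) := by linarith
  rw [hx4]
  linarith

lemma facetPolytope_subset_hesse : facetPolytope ⊆ Hesse := by
  intro α hα
  by_contra hmem
  have hfin : (({v | ∃ i j : Fin 8, i < j ∧ v = e i + e j} ∪
      {v | ∃ i j : Fin 8, i < j ∧ v = ρ - e i - e j}) : Set (Fin 8 → ℝ)).Finite := by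
    refine ((Set.finite_range fun p : Fin 8 × Fin 8 => e p.1 + e p.2).subset ?_).union
      ((Set.finite_range fun p : Fin 8 × Fin 8 => ρ - e p.1 - e p.2).subset ?_) <;>
    · rintro v ⟨i, j, -, rfl⟩
      exact ⟨(i, j), rfl⟩
  obtain ⟨F, u, hF, hu⟩ := geometric_hahn_banach_closed_point (convex_convexHull ℝ _)
    (hfin.isClosed_convexHull ℝ) hmem
  obtain ⟨g, hg⟩ : ∃ g : Fin 8 → ℝ, ∀ v, F v = dot v g := by
    refine ⟨fun i => F (Pi.single i 1), fun v => ?_⟩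
    conv_lhs => rw [pi_eq_sum_univ' v]
    simp [dot, map_sum]
  have hlt : ∀ v ∈ Hesse, dot v g < dot α g := fun v hv => by
    rw [← hg, ← hg]
    exact (hF v hv).trans hu
  have hplus : ∀ i j, i ≠ j → g i + g j < dot α g := fun i j hij => by
    have hv : e i + e j ∈ Hesse := by
      refine subset_convexHull ℝ _ (Or.inl ?_)
      rcases hij.lt_or_gt with h | h
      · exact ⟨i, j, h, rfl⟩
      · exact ⟨j, i, h, add_comm _ _⟩
    have h := hlt _ hv
    rwa [dot_comm, dot_add_right, dot_e, dot_e] at h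
  have hminus : ∀ i j, i ≠ j → dot ρ g - g i - g j < dot α g := fun i j hij => by
    have hv : ρ - e i - e j ∈ Hesse := by
      refine subset_convexHull ℝ _ (Or.inr ?_)
      rcases hij.lt_or_gt with h | h
      · exact ⟨i, j, h, rfl⟩
      · exact ⟨j, i, h, sub_right_comm _ _ _⟩
    have h := hlt _ hv
    rwa [dot_comm, dot_sub_right, dot_sub_right, dot_e, dot_e, dot_comm] at h
  obtain ⟨σ, hσ⟩ : ∃ σ : Equiv.Perm (Fin 8), Monotone (g ∘ σ) := ⟨_, Tuple.monotone_sort g⟩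
  have h_perm : ∀ x y : Fin 8 → ℝ, ∀ τ : Equiv.Perm (Fin 8), dot (x ∘ τ) (y ∘ τ) = dot x y :=
    fun x y τ => by
      rw [dot_comp_perm]
      congr 1
      ext i
      simp
  rcases le_total (g (σ 2) + g (σ 3) + g (σ 4) + g (σ 5))
    (g (σ 0) + g (σ 1) + g (σ 6) + g (σ 7)) with hle | hle
  · have h := dot_le_of_antitone (f := g ∘ (Fin.revPerm.trans σ))
      (comp_perm_mem_facetPolytope (Fin.revPerm.trans σ) hα)
      (fun i j hij => hσ (Fin.rev_le_rev.2 hij))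
      (show g (σ 5) + g (σ 4) + g (σ 3) + g (σ 2) ≤ g (σ 7) + g (σ 6) + g (σ 1) + g (σ 0) by
        linarith)
    rw [h_perm] at h
    exact absurd h (not_le.2 (hplus (σ 7) (σ 6) (by simp)))
  · have h := dot_le_of_antitone (f := (-g) ∘ σ)
      (comp_perm_mem_facetPolytope σ (rho_sub_mem_facetPolytope hα))
      (fun i j hij => neg_le_neg (hσ hij))
      (show -g (σ 2) + -g (σ 3) + -g (σ 4) + -g (σ 5) ≤
        -g (σ 0) + -g (σ 1) + -g (σ 6) + -g (σ 7) by linarith)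
    rw [h_perm, dot_neg_right, dot_sub_left] at h
    have h' := hminus (σ 0) (σ 1) (by simp)
    simp only [Function.comp_apply, Pi.neg_apply] at h
    linarith

theorem statement8 :
    Hesse =
      {α : Fin 8 → ℝ |
        dot α ρ = 1 ∧
        (∀ δ ∈ RE7, dot α δ ≤ 1) ∧
        (∀ μ ∈ LatticeE8, dot μ ρ = 1 → dot μ μ = 4 → dot α μ ≤ 2)} := by
  exact hesse_subset_facetPolytope.antisymm facetPolytope_subset_hesse
end
end

section
/- Let V be a finite set of points in a real vector space and let p = Σ_{v∈V} a_v v be a convex combination of the points of V (so a_v ≥ 0 for all v and Σ_{v∈V} a_v = 1). Then the convex hull of V equals the union over all v ∈ V with a_v > 0 of the convex hulls of (V \ {v}) ∪ {p}. -/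
theorem statement10 {E : Type*} [AddCommGroup E] [Module ℝ E]
    (V : Finset E) (a : E → ℝ) (ha : ∀ v ∈ V, 0 ≤ a v) (hsum : ∑ v ∈ V, a v = 1)
    (p : E) (hp : p = ∑ v ∈ V, a v • v) :
    convexHull ℝ (V : Set E) =
      ⋃ v ∈ {v : E | v ∈ V ∧ 0 < a v},
        convexHull ℝ (((V : Set E) \ {v}) ∪ {p}) := by
  classical
  apply Set.Subset.antisymm
  · intro x hx
    obtain ⟨b, hb, hb1, hbx⟩ := Finset.mem_convexHull'.1 hx
    have hne : (V.filter fun v => 0 < a v).Nonempty := by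
      by_contra h
      rw [Finset.not_nonempty_iff_eq_empty, Finset.filter_eq_empty_iff] at h
      linarith [Finset.sum_nonpos fun v hv => not_lt.1 (h hv)]
    -- The removed vertex minimizes the ratio of the weights of `x` and `p`.
    obtain ⟨u, hu, hmin⟩ := Finset.exists_min_image _ (fun v => b v / a v) hne
    rw [Finset.mem_filter] at hu
    obtain ⟨huV, hau⟩ := hu
    set t := b u / a u with ht
    have ht0 : 0 ≤ t := div_nonneg (hb u huV) hau.le
    have hu0 : b u - t * a u = 0 := by rw [ht]; field_simp; simp
    have hnonneg : ∀ v ∈ V, 0 ≤ b v - t * a v := by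
      intro v hv
      rcases (ha v hv).eq_or_lt with h | h
      · simpa [← h] using hb v hv
      · have := (le_div_iff₀ h).1 (hmin v (Finset.mem_filter.2 ⟨hv, h⟩))
        linarith
    simp only [Set.mem_iUnion]
    refine ⟨u, ⟨huV, hau⟩, ?_⟩
    have hmem := (convex_convexHull ℝ ((V : Set E) \ {u} ∪ {p})).sum_mem (t := V)
      (w := fun v => (b v - t * a v) + if v = u then t else 0)
      (z := fun v => if v = u then p else v)
      (fun v hv => add_nonneg (hnonneg v hv) (by split_ifs <;> simp [ht0]))
      (by
        rw [Finset.sum_add_distrib, Finset.sum_sub_distrib, ← Finset.mul_sum, hb1, hsum]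
        simp [huV])
      (fun v hv => subset_convexHull ℝ _ (by
        by_cases h : v = u
        · simp [h]
        · simpa [h] using Or.inr hv))
    have hcongr : ∀ v ∈ V, ((b v - t * a v) + if v = u then t else 0) •
        (if v = u then p else v) =
          (b v • v - t • a v • v) + if v = u then t • p else 0 := by
      intro v _
      rw [smul_smul, ← sub_smul]
      split_ifs with h
      · subst h
        simp [hu0]
      · simp
    rw [Finset.sum_congr rfl hcongr, Finset.sum_add_distrib, Finset.sum_sub_distrib,
      ← Finset.smul_sum, ← hp, hbx, Finset.sum_ite_eq' V u, if_pos huV, sub_add_cancel] at hmem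
    exact hmem
  · refine Set.iUnion₂_subset fun v _ => convexHull_min ?_ (convex_convexHull ℝ _)
    refine Set.union_subset (Set.sdiff_subset.trans (subset_convexHull ℝ _)) ?_
    rw [Set.singleton_subset_iff, hp]
    exact (convex_convexHull ℝ _).sum_mem ha hsum fun v hv => subset_convexHull ℝ _ hv
end
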